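/- arXiv:1206.5766 — 3 statements merged into one kernel-verified Lean document; each statement's English description precedes it below -/
import Mathlib

section
/- In the mixture of spherical Gaussians model, let μ̄ := E[x] = Σ_{i=1}^k w_i μ_i and σ̄² := Σ_{i=1}^k w_i σ_i². Then the covariance matrix E[(x − μ̄)(x − μ̄)ᵀ] equals Σ_{i=1}^k w_i (μ_i − μ̄)(μ_i − μ̄)ᵀ + σ̄² I; its smallest eigenvalue is σ̄², the d − r smallest eigenvalues are all equal to σ̄² where r ≤ k − 1 is the rank of Σ_{i=1}^k w_i (μ_i − μ̄)(μ_i − μ̄)ᵀ, all other eigenvalues are strictly larger than σ̄², and every eigenvector v of the covariance matrix with eigenvalue σ̄² satisfies vᵀ(μ_i − μ̄) = 0 for all i ∈ [k]. -/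
open MeasureTheory ProbabilityTheory Matrix
open scoped BigOperators NNReal

lemma aux_memLp {d : ℕ} (m : Fin d → ℝ) (s : ℝ≥0) (i : Fin d) :
    MemLp (fun y : Fin d → ℝ => y i) 2 (Measure.pi fun j => gaussianReal (m j) s) := by
  have h1 : MemLp (id : ℝ → ℝ) 2 (gaussianReal (m i) s) := memLp_id_gaussianReal 2
  exact h1.comp_measurePreserving (measurePreserving_eval (fun j => gaussianReal (m j) s) i)

lemma aux_mean {d : ℕ} (m : Fin d → ℝ) (s : ℝ≥0) (i : Fin d) :
    ∫ y : Fin d → ℝ, y i ∂(Measure.pi fun j => gaussianReal (m j) s) = m i := by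
  have h1 := integral_comp_eval (μ := fun j => gaussianReal (m j) s) (i := i) (f := (id : ℝ → ℝ))
    aestronglyMeasurable_id
  simpa using h1

lemma aux_cov {d : ℕ} (m : Fin d → ℝ) (s : ℝ≥0) (i j : Fin d) :
    cov[fun y : Fin d → ℝ => y i, fun y => y j; Measure.pi fun j => gaussianReal (m j) s]
      = if i = j then (s : ℝ) else 0 := by
  split_ifs with hij
  · subst hij
    rw [covariance_self (measurable_pi_apply i).aemeasurable]
    have h2 : Var[fun y : Fin d → ℝ => y i; Measure.pi fun j => gaussianReal (m j) s]
      = Var[id; (Measure.pi fun j => gaussianReal (m j) s).map (fun y => y i)] := by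
      rw [variance_map aemeasurable_id (measurable_pi_apply i).aemeasurable]; rfl
    rw [h2]
    change Var[id; (Measure.pi fun j => gaussianReal (m j) s).map (Function.eval i)] = _
    rw [(measurePreserving_eval (fun j => gaussianReal (m j) s) i).map_eq]
    exact variance_id_gaussianReal
  · have h4 : iIndepFun (fun (i : Fin d) (y : Fin d → ℝ) => y i)
        (Measure.pi fun j => gaussianReal (m j) s) :=
      iIndepFun_pi (X := fun _ => id) (fun _ => aemeasurable_id)
    exact (h4.indepFun hij).covariance_eq_zero (aux_memLp m s i) (aux_memLp m s j)

lemma aux_second {d : ℕ} (m : Fin d → ℝ) (s : ℝ≥0) (c : Fin d → ℝ) (i j : Fin d) :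
    ∫ y : Fin d → ℝ, (y i - c i) * (y j - c j) ∂(Measure.pi fun j => gaussianReal (m j) s)
      = (m i - c i) * (m j - c j) + if i = j then (s : ℝ) else 0 := by
  set Q := (Measure.pi fun j => gaussianReal (m j) s)
  have hi := aux_memLp m s i
  have hj := aux_memLp m s j
  have h1 := aux_cov m s i j
  have hI : Integrable (fun y : Fin d → ℝ => y i) Q := hi.integrable one_le_two
  have hJ : Integrable (fun y : Fin d → ℝ => y j) Q := hj.integrable one_le_two
  have hc : cov[fun y : Fin d → ℝ => y i - c i, fun y => y j - c j; Q]
      = cov[fun y : Fin d → ℝ => y i, fun y => y j; Q] := by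
    rw [covariance_sub_const_left hI, covariance_sub_const_right hJ]
  rw [h1, covariance_eq_sub (X := fun y : Fin d → ℝ => y i - c i)
    (Y := fun y : Fin d → ℝ => y j - c j)
    (hi.sub (memLp_const (c i))) (hj.sub (memLp_const (c j))),
    integral_sub hI (integrable_const _), integral_sub hJ (integrable_const _),
    aux_mean, aux_mean] at hc
  simp only [integral_const, probReal_univ, smul_eq_mul, one_mul, Pi.mul_apply] at hc
  linarith

lemma aux_mix {Ω : Type} [MeasurableSpace Ω] (P : Measure Ω) [IsProbabilityMeasure P]
    (d k : ℕ) (w : Fin k → ℝ) (μ : Fin k → Fin d → ℝ) (σ2 : Fin k → ℝ≥0)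
    (h : Ω → Fin k) (x : Ω → Fin d → ℝ)
    (hmeas_h : Measurable h) (hmeas_x : Measurable x)
    (hw_pos : ∀ i, 0 < w i)
    (hprob : ∀ i, P (h ⁻¹' {i}) = ENNReal.ofReal (w i))
    (hcond : ∀ i, (ProbabilityTheory.cond P (h ⁻¹' {i})).map x
        = Measure.pi fun j => ProbabilityTheory.gaussianReal (μ i j) (σ2 i))
    (f : (Fin d → ℝ) → ℝ) (hf : Measurable f)
    (hint : ∀ i, Integrable f (Measure.pi fun j => gaussianReal (μ i j) (σ2 i))) :
    ∫ ω, f (x ω) ∂P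
      = ∑ i, w i * ∫ y, f y ∂(Measure.pi fun j => gaussianReal (μ i j) (σ2 i)) := by
  have hmap : P.map x = Measure.sum (fun i => ENNReal.ofReal (w i) •
      (Measure.pi fun j => gaussianReal (μ i j) (σ2 i))) := by
    ext s hs
    rw [Measure.sum_apply _ hs, tsum_fintype, Measure.map_apply hmeas_x hs]
    simp_rw [← hcond, Measure.smul_apply, Measure.map_apply hmeas_x hs, ← hprob, smul_eq_mul]
    have hms : ∀ i, MeasurableSet (h ⁻¹' {i}) := fun i => hmeas_h (measurableSet_singleton i)
    have h2 : ∀ i, P (h ⁻¹' {i}) * (P[|h ⁻¹' {i}]) (x ⁻¹' s) = P (h ⁻¹' {i} ∩ x ⁻¹' s) := by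
      intro i
      rw [mul_comm, cond_mul_eq_inter (hms i)]
    simp_rw [h2]
    rw [← tsum_fintype (L := .unconditional _), ← measure_iUnion]
    · congr 1; ext ω; simp
    · intro a b hab
      refine Set.disjoint_left.2 ?_
      rintro ω ⟨h1, _⟩ ⟨h3, _⟩
      exact hab (h1.symm.trans h3)
    · intro i; exact (hms i).inter (hmeas_x hs)
  rw [← integral_map hmeas_x.aemeasurable hf.aestronglyMeasurable, hmap, Measure.sum_fintype,
    integral_finsetSum_measure]
  · refine Finset.sum_congr rfl fun i _ => ?_
    rw [integral_smul_measure, ENNReal.toReal_ofReal (hw_pos i).le, smul_eq_mul]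
  · intro i _
    exact (hint i).smul_measure ENNReal.ofReal_ne_top

/-- **Covariance structure of a mixture of spherical Gaussians.**
For the model `x = μ_h + z` with `Pr(h = i) = w i` and `z | h = i ~ N(0, σ_i² I)` in `ℝ^d`
(expressed by saying that the conditional law of `x` given `h = i` is the spherical Gaussian
`N(μ i, σ_i² I)`), under the non-degeneracy condition, putting `μ̄ = E[x]` and
`σ̄² = ∑ i, w i * σ_i²`, the covariance matrix `E[(x − μ̄)(x − μ̄)ᵀ]` equals
`∑ i, w i (μ i − μ̄)(μ i − μ̄)ᵀ + σ̄² I`; the matrix `B := ∑ i, w i (μ i − μ̄)(μ i − μ̄)ᵀ` has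
rank `r ≤ k − 1`; `σ̄²` is an eigenvalue of the covariance matrix and every eigenvalue is
at least `σ̄²` (so `σ̄²` is the smallest eigenvalue), and any other eigenvalue is strictly
larger; the eigenspace of `σ̄²` has dimension `d − r` (the `d − r` smallest eigenvalues all
equal `σ̄²`); and every eigenvector `v` for the eigenvalue `σ̄²` satisfies
`vᵀ (μ i − μ̄) = 0` for all `i`. -/
theorem mixture_covariance_structure
    {Ω : Type} [MeasurableSpace Ω] (P : Measure Ω) [IsProbabilityMeasure P]
    (d k : ℕ) (w : Fin k → ℝ) (μ : Fin k → Fin d → ℝ) (σ2 : Fin k → ℝ≥0)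
    (h : Ω → Fin k) (x : Ω → Fin d → ℝ)
    (hmeas_h : Measurable h) (hmeas_x : Measurable x)
    -- mixing weights: a strictly positive probability vector
    (hw_pos : ∀ i, 0 < w i) (hw_sum : ∑ i, w i = 1)
    (hprob : ∀ i, P (h ⁻¹' {i}) = ENNReal.ofReal (w i))
    -- conditionally on `h = i`, `x` is a spherical Gaussian `N(μ i, σ2 i • I)`
    (hcond : ∀ i, (ProbabilityTheory.cond P (h ⁻¹' {i})).map x
        = Measure.pi fun j => ProbabilityTheory.gaussianReal (μ i j) (σ2 i))
    -- non-degeneracy: the means matrix `A = [μ_1 | ⋯ | μ_k]` has column rank `k`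
    (hrank : (Matrix.of fun (r : Fin d) (c : Fin k) => μ c r).rank = k)
    -- abbreviations: overall mean, average variance, covariance matrix, between-means matrix
    (μbar : Fin d → ℝ) (hμbar : ∀ i, μbar i = ∫ ω, x ω i ∂P)
    (σbar2 : ℝ) (hσbar2 : σbar2 = ∑ i, w i * (σ2 i : ℝ))
    (Cov : Matrix (Fin d) (Fin d) ℝ)
    (hCov : Cov = Matrix.of fun i j => ∫ ω, (x ω i - μbar i) * (x ω j - μbar j) ∂P)
    (B : Matrix (Fin d) (Fin d) ℝ)
    (hB : B = ∑ i, w i • Matrix.vecMulVec (fun r => μ i r - μbar r) (fun r => μ i r - μbar r)) :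
    Cov = B + σbar2 • (1 : Matrix (Fin d) (Fin d) ℝ) ∧
    B.rank ≤ k - 1 ∧
    (∃ v : Fin d → ℝ, v ≠ 0 ∧ Cov *ᵥ v = σbar2 • v) ∧
    (∀ (t : ℝ) (v : Fin d → ℝ), v ≠ 0 → Cov *ᵥ v = t • v → σbar2 ≤ t) ∧
    (∀ (t : ℝ) (v : Fin d → ℝ), v ≠ 0 → Cov *ᵥ v = t • v → t ≠ σbar2 → σbar2 < t) ∧
    Module.finrank ℝ
      (Module.End.eigenspace (Matrix.toLin' Cov) σbar2) = d - B.rank ∧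
    (∀ v : Fin d → ℝ, Cov *ᵥ v = σbar2 • v → ∀ i, v ⬝ᵥ (fun r => μ i r - μbar r) = 0) := by
  have hmean : ∀ j, μbar j = ∑ i, w i * μ i j := by
    intro j
    rw [hμbar, aux_mix P d k w μ σ2 h x hmeas_h hmeas_x hw_pos hprob hcond (fun y => y j)
      (by fun_prop) (fun i => (aux_memLp (μ i) (σ2 i) j).integrable one_le_two)]
    simp_rw [aux_mean]
  have hCB : Cov = B + σbar2 • (1 : Matrix (Fin d) (Fin d) ℝ) := by
    ext a b
    rw [hCov, hB, hσbar2, Matrix.of_apply,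
      aux_mix P d k w μ σ2 h x hmeas_h hmeas_x hw_pos hprob hcond
      (fun y => (y a - μbar a) * (y b - μbar b)) (by fun_prop)
      (fun i => MemLp.integrable_mul (((aux_memLp (μ i) (σ2 i) a).sub (memLp_const (μbar a))))
        ((aux_memLp (μ i) (σ2 i) b).sub (memLp_const (μbar b))))]
    simp_rw [aux_second]
    simp only [Matrix.add_apply, Matrix.sum_apply, Matrix.smul_apply, vecMulVec_apply,
      Matrix.one_apply, smul_eq_mul, mul_add, Finset.sum_add_distrib, Finset.sum_mul]
    congr 1
    refine Finset.sum_congr rfl fun i _ => ?_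
    split_ifs <;> simp
  -- matrix of centered means
  set U : Matrix (Fin d) (Fin k) ℝ := Matrix.of fun r c => μ c r - μbar r with hU
  have hBU : B = U * (Matrix.diagonal w * Uᵀ) := by
    ext a b
    rw [hB, Matrix.mul_apply]
    simp only [Matrix.sum_apply, Matrix.smul_apply, vecMulVec_apply, smul_eq_mul,
      Matrix.diagonal_mul, hU, Matrix.of_apply, Matrix.transpose_apply]
    exact Finset.sum_congr rfl fun i _ => by ring
  have hk : 0 < k := by
    rcases Nat.eq_zero_or_pos k with h0 | h0
    · subst h0; simp at hw_sum
    · exact h0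
  have hUw : U *ᵥ w = 0 := by
    ext a
    simp only [Matrix.mulVec, dotProduct, hU, Matrix.of_apply, Pi.zero_apply, sub_mul,
      Finset.sum_sub_distrib, ← Finset.mul_sum, hw_sum, hmean a]
    rw [mul_one, sub_eq_zero]
    exact Finset.sum_congr rfl fun i _ => mul_comm _ _
  have hUr : U.rank ≤ k - 1 := by
    have h1 := LinearMap.finrank_range_add_finrank_ker U.mulVecLin
    rw [Module.finrank_fin_fun] at h1
    have h2 : 0 < Module.finrank ℝ (LinearMap.ker U.mulVecLin) := by
      rw [Module.finrank_pos_iff_exists_ne_zero]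
      refine ⟨⟨w, by simpa using hUw⟩, ?_⟩
      intro h0
      have h3 : w = 0 := congrArg Subtype.val h0
      have := hw_pos ⟨0, hk⟩
      rw [h3] at this
      simp at this
    unfold Matrix.rank
    omega
  have hBr : B.rank ≤ k - 1 := by
    rw [hBU]; exact (Matrix.rank_mul_le_left _ _).trans hUr
  have hkd : k ≤ d := by
    have := Matrix.rank_le_height (Matrix.of fun (r : Fin d) (c : Fin k) => μ c r)
    omega
  have hev : ∀ (t : ℝ) (v : Fin d → ℝ), Cov *ᵥ v = t • v ↔ B *ᵥ v = (t - σbar2) • v := by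
    intro t v
    rw [hCB, Matrix.add_mulVec, Matrix.smul_mulVec, Matrix.one_mulVec, sub_smul, eq_sub_iff_add_eq]
  have hev0 : ∀ (v : Fin d → ℝ), Cov *ᵥ v = σbar2 • v ↔ B *ᵥ v = 0 := by
    intro v; rw [hev, sub_self, zero_smul]
  have hquad : ∀ v : Fin d → ℝ, v ⬝ᵥ (B *ᵥ v)
      = ∑ i, w i * (v ⬝ᵥ (fun r => μ i r - μbar r)) ^ 2 := by
    intro v
    rw [hB, Matrix.sum_mulVec, dotProduct_sum]
    refine Finset.sum_congr rfl fun i _ => ?_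
    rw [Matrix.smul_mulVec, dotProduct_smul, Matrix.vecMulVec_mulVec, dotProduct_comm _ v]
    simp only [op_smul_eq_smul, dotProduct_smul, smul_eq_mul]
    ring
  have hge : ∀ (t : ℝ) (v : Fin d → ℝ), v ≠ 0 → Cov *ᵥ v = t • v → σbar2 ≤ t := by
    intro t v hv hc
    rw [hev] at hc
    have h1 := hquad v
    rw [hc, dotProduct_smul, smul_eq_mul] at h1
    have h2 : 0 ≤ (t - σbar2) * (v ⬝ᵥ v) := by
      rw [h1]; exact Finset.sum_nonneg fun i _ => mul_nonneg (hw_pos i).le (sq_nonneg _)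
    have h3 : 0 < v ⬝ᵥ v := by
      refine lt_of_le_of_ne (Finset.sum_nonneg fun i _ => mul_self_nonneg _) ?_
      intro h0; exact hv (dotProduct_self_eq_zero.1 h0.symm)
    have := nonneg_of_mul_nonneg_left h2 h3
    linarith
  have hker : Module.End.eigenspace (Matrix.toLin' Cov) σbar2 = LinearMap.ker B.mulVecLin := by
    ext v
    rw [Module.End.mem_eigenspace_iff, Matrix.toLin'_apply, hev0, LinearMap.mem_ker,
      Matrix.mulVecLin_apply]
  have hfr : Module.finrank ℝ (LinearMap.ker B.mulVecLin) = d - B.rank := by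
    have h1 := LinearMap.finrank_range_add_finrank_ker B.mulVecLin
    rw [Module.finrank_fin_fun] at h1
    unfold Matrix.rank
    omega
  refine ⟨hCB, hBr, ?_, hge, fun t v hv hc hne => lt_of_le_of_ne (hge t v hv hc) hne.symm,
    by rw [hker, hfr], ?_⟩
  · have h1 : 0 < Module.finrank ℝ (LinearMap.ker B.mulVecLin) := by omega
    rw [Module.finrank_pos_iff_exists_ne_zero] at h1
    obtain ⟨⟨v, hv⟩, hne⟩ := h1
    refine ⟨v, fun h0 => hne (Subtype.ext h0), (hev0 v).2 (by simpa using hv)⟩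
  · intro v hv i
    have h1 := hquad v
    rw [(hev0 v).1 hv, dotProduct_zero] at h1
    have h2 := (Finset.sum_eq_zero_iff_of_nonneg
      (fun i _ => mul_nonneg (hw_pos i).le (sq_nonneg _))).1 h1.symm i (Finset.mem_univ i)
    have h3 := (mul_eq_zero.1 h2).resolve_left (hw_pos i).ne'
    exact pow_eq_zero_iff (two_ne_zero) |>.1 h3
end

section
/- In the mixture of spherical Gaussians model, let σ̄² := Σ_{i=1}^k w_i σ_i² and let v ∈ ℝ^d be any unit-norm eigenvector of the covariance matrix E[(x − E[x])(x − E[x])ᵀ] corresponding to the eigenvalue σ̄². Then M_1 := E[x (vᵀ(x − E[x]))²] = Σ_{i=1}^k w_i σ_i² μ_i, and M_2 := E[x xᵀ] − σ̄² I = Σ_{i=1}^k w_i μ_i μ_iᵀ. -/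
open MeasureTheory ProbabilityTheory Matrix
open scoped BigOperators NNReal

/-- centered spherical Gaussian -/
noncomputable def gz (d : ℕ) (s : ℝ≥0) : Measure (Fin d → ℝ) :=
  Measure.pi fun _ => gaussianReal 0 s

instance gz_prob (d : ℕ) (s : ℝ≥0) : IsProbabilityMeasure (gz d s) := by
  unfold gz; infer_instance

/-- all finite moments -/
def AllLp {α : Type*} [MeasurableSpace α] (ν : Measure α) (f : α → ℝ) : Prop :=
  ∀ p : ℝ≥0, MemLp f p ν

lemma AllLp.add {α : Type*} [MeasurableSpace α] {ν : Measure α} {f g : α → ℝ}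
    (hf : AllLp ν f) (hg : AllLp ν g) : AllLp ν (fun x => f x + g x) :=
  fun p => (hf p).add (hg p)

lemma AllLp.mul {α : Type*} [MeasurableSpace α] {ν : Measure α} {f g : α → ℝ}
    (hf : AllLp ν f) (hg : AllLp ν g) : AllLp ν (fun x => f x * g x) := by
  intro p
  have : ENNReal.HolderTriple ((2 * p : ℝ≥0) : ENNReal) ((2 * p : ℝ≥0) : ENNReal) (p : ENNReal) := by
    constructor
    rw [ENNReal.coe_mul, ENNReal.mul_inv (by simp) (by simp), ← add_mul]
    simp [ENNReal.inv_two_add_inv_two]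
  exact (hg (2 * p)).mul' (hf (2 * p))

lemma AllLp.const {α : Type*} [MeasurableSpace α] {ν : Measure α} [IsFiniteMeasure ν] (c : ℝ) :
    AllLp ν (fun _ => c) := fun _ => memLp_const c

lemma AllLp.sum {α ι : Type*} [MeasurableSpace α] {ν : Measure α} (s : Finset ι) {f : ι → α → ℝ}
    (hf : ∀ i ∈ s, AllLp ν (f i)) : AllLp ν (fun x => ∑ i ∈ s, f i x) :=
  fun p => memLp_finsetSum s fun i hi => hf i hi p

lemma AllLp.integrable {α : Type*} [MeasurableSpace α] {ν : Measure α} {f : α → ℝ}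
    (hf : AllLp ν f) : Integrable f ν := by
  have := hf 1
  exact memLp_one_iff_integrable.1 (by simpa using this)

lemma allLp_coord (d : ℕ) (s : ℝ≥0) (a : Fin d) : AllLp (gz d s) (fun z => z a) := fun p =>
  (memLp_id_gaussianReal (μ := 0) (v := s) p).comp_measurePreserving
    (measurePreserving_eval (fun _ : Fin d => gaussianReal 0 s) a)

lemma allLp_dot (d : ℕ) (s : ℝ≥0) (v : Fin d → ℝ) : AllLp (gz d s) (fun z => v ⬝ᵥ z) := by
  unfold dotProduct
  exact AllLp.sum _ fun i _ => (AllLp.const (v i)).mul (allLp_coord d s i)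

lemma gz_odd (d : ℕ) (s : ℝ≥0) (f : (Fin d → ℝ) → ℝ)
    (hodd : ∀ z, f (-z) = - f z) : ∫ z, f z ∂(gz d s) = 0 := by
  have hmp : MeasurePreserving (fun (z : Fin d → ℝ) => -z) (gz d s) (gz d s) :=
    measurePreserving_pi (fun _ : Fin d => gaussianReal 0 s) (fun _ : Fin d => gaussianReal 0 s)
      (f := fun _ t => -t) (fun _ => ⟨measurable_neg, by simpa using gaussianReal_map_neg (μ := 0) (v := s)⟩)
  have h1 := hmp.integral_comp (MeasurableEquiv.neg (Fin d → ℝ)).measurableEmbedding f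
  simp only [hodd, integral_neg] at h1
  linarith

lemma gz_mul (d : ℕ) (s : ℝ≥0) (a b : Fin d) :
    ∫ z, z a * z b ∂(gz d s) = if a = b then (s : ℝ) else 0 := by
  split_ifs with hab
  · subst hab
    have h1 : ∫ z, z a * z a ∂(gz d s) = ∫ t, t * t ∂(gaussianReal 0 s) :=
      integral_comp_eval (μ := fun _ : Fin d => gaussianReal 0 s) (i := a) (f := fun t : ℝ => t * t)
        (by fun_prop)
    have h2 := variance_id_gaussianReal (μ := 0) (v := s)
    rw [variance_of_integral_eq_zero (by fun_prop) (by simp [integral_id_gaussianReal])] at h2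
    rw [h1, ← h2]
    simp [sq]
  · have hi : IndepFun (fun z : Fin d → ℝ => z a) (fun z => z b) (gz d s) :=
      (iIndepFun_pi (μ := fun _ : Fin d => gaussianReal 0 s) (X := fun _ t => t)
        (fun _ => by fun_prop)).indepFun hab
    rw [hi.integral_fun_mul_eq_mul_integral (measurable_pi_apply a).aestronglyMeasurable
      (measurable_pi_apply b).aestronglyMeasurable,
      gz_odd d s (fun z => z a) (by simp), zero_mul]

lemma gz_second (d : ℕ) (s : ℝ≥0) (a b : Fin d) (α β : ℝ) :
    ∫ z, (z a + α) * (z b + β) ∂(gz d s) = (if a = b then (s : ℝ) else 0) + α * β := by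
  have ha := allLp_coord d s a
  have hb := allLp_coord d s b
  have e : ∀ z : Fin d → ℝ, (z a + α) * (z b + β) = (z a * z b + (β * z a + α * z b)) + α * β := by
    intro z; ring
  simp only [e]
  rw [integral_add, integral_add, gz_mul, gz_odd d s (fun z => β * z a + α * z b)]
  · simp
  · intro z; simp; ring
  · exact (ha.mul hb).integrable
  · exact (((AllLp.const β).mul ha).add ((AllLp.const α).mul hb)).integrable
  · exact ((ha.mul hb).add (((AllLp.const β).mul ha).add ((AllLp.const α).mul hb))).integrable
  · exact (AllLp.const _).integrable

lemma gz_dot_sq (d : ℕ) (s : ℝ≥0) (v : Fin d → ℝ) :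
    ∫ z, (v ⬝ᵥ z) * (v ⬝ᵥ z) ∂(gz d s) = s * (v ⬝ᵥ v) := by
  have e : ∀ z : Fin d → ℝ, (v ⬝ᵥ z) * (v ⬝ᵥ z) = ∑ a, ∑ b, (v a * v b) * (z a * z b) := by
    intro z
    simp only [dotProduct, Finset.sum_mul_sum]
    refine Finset.sum_congr rfl fun a _ => Finset.sum_congr rfl fun b _ => by ring
  have hI : ∀ a b, AllLp (gz d s) (fun z => (v a * v b) * (z a * z b)) := fun a b =>
    (AllLp.const _).mul ((allLp_coord d s a).mul (allLp_coord d s b))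
  simp only [e]
  rw [integral_finsetSum _ fun a _ => (AllLp.sum _ fun b _ => hI a b).integrable]
  simp only [integral_finsetSum _ fun b _ => (hI _ b).integrable, integral_const_mul, gz_mul]
  simp [dotProduct, Finset.mul_sum, mul_comm]

lemma gz_third (d : ℕ) (s : ℝ≥0) (v : Fin d → ℝ) (a : Fin d) (α : ℝ) :
    ∫ z, (z a + α) * ((v ⬝ᵥ z) * (v ⬝ᵥ z)) ∂(gz d s) = α * (s * (v ⬝ᵥ v)) := by
  have hv := (allLp_dot d s v).mul (allLp_dot d s v)
  simp only [add_mul]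
  rw [integral_add ((allLp_coord d s a).mul hv).integrable ((AllLp.const α).mul hv).integrable,
    integral_const_mul, gz_dot_sq, gz_odd d s (fun z => z a * ((v ⬝ᵥ z) * (v ⬝ᵥ z)))]
  · simp
  · intro z; simp

lemma pi_gauss_eq (d : ℕ) (s : ℝ≥0) (m : Fin d → ℝ) :
    (Measure.pi fun j => gaussianReal (m j) s) = (gz d s).map (fun z j => z j + m j) := by
  have := (measurePreserving_pi (fun _ : Fin d => gaussianReal 0 s)
    (fun j : Fin d => gaussianReal (m j) s)
      (f := fun j t => t + m j) (fun j => ⟨by fun_prop, by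
        simpa using gaussianReal_map_add_const (μ := 0) (v := s) (m j)⟩)).map_eq
  exact this.symm

lemma mix_integral {Ω : Type} [MeasurableSpace Ω] (P : Measure Ω) [IsProbabilityMeasure P]
    (d k : ℕ) (w : Fin k → ℝ) (μ : Fin k → Fin d → ℝ) (σ2 : Fin k → ℝ≥0)
    (h : Ω → Fin k) (x : Ω → Fin d → ℝ)
    (hmeas_h : Measurable h) (hmeas_x : Measurable x)
    (hw_pos : ∀ i, 0 < w i)
    (hprob : ∀ i, P (h ⁻¹' {i}) = ENNReal.ofReal (w i))
    (hcond : ∀ i, (ProbabilityTheory.cond P (h ⁻¹' {i})).map x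
        = Measure.pi fun j => ProbabilityTheory.gaussianReal (μ i j) (σ2 i))
    (g : (Fin d → ℝ) → ℝ) (hg : Measurable g)
    (hint : ∀ i, Integrable (fun z : Fin d → ℝ => g (fun j => z j + μ i j)) (gz d (σ2 i))) :
    ∫ ω, g (x ω) ∂P = ∑ i, w i * ∫ z, g (fun j => z j + μ i j) ∂(gz d (σ2 i)) := by
  have hsh : ∀ i, Measurable (fun (z : Fin d → ℝ) j => z j + μ i j) := fun i => by fun_prop
  have hI : ∀ i, Integrable (fun ω => g (x ω)) (ProbabilityTheory.cond P (h ⁻¹' {i})) := by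
    intro i
    have : Integrable g ((ProbabilityTheory.cond P (h ⁻¹' {i})).map x) := by
      rw [hcond, pi_gauss_eq, integrable_map_measure hg.aestronglyMeasurable (hsh i).aemeasurable]
      exact hint i
    exact (integrable_map_measure hg.aestronglyMeasurable hmeas_x.aemeasurable).1 this
  have hE : ∀ i, ∫ ω, g (x ω) ∂(ProbabilityTheory.cond P (h ⁻¹' {i}))
      = ∫ z, g (fun j => z j + μ i j) ∂(gz d (σ2 i)) := by
    intro i
    rw [← integral_map hmeas_x.aemeasurable hg.aestronglyMeasurable, hcond, pi_gauss_eq,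
      integral_map (hsh i).aemeasurable hg.aestronglyMeasurable]
  conv_lhs => rw [← sum_meas_smul_cond_fiber hmeas_h P]
  rw [integral_finsetSum_measure]
  · refine Finset.sum_congr rfl fun i _ => ?_
    rw [integral_smul_measure, hE, hprob, ENNReal.toReal_ofReal (hw_pos i).le, smul_eq_mul]
  · intro i _
    exact (hI i).smul_measure (measure_ne_top _ _)

/-- **Observable moment structure (first and second order).**
In the mixture of spherical Gaussians model, with `σ̄² = ∑ i, w i * σ_i²` and `v` any
unit-norm eigenvector of the covariance matrix with eigenvalue `σ̄²`:
`M₁ := E[x (vᵀ(x − E[x]))²] = ∑ i, w i σ_i² μ i` and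
`M₂ := E[x xᵀ] − σ̄² I = ∑ i, w i μ i μ iᵀ`. -/
theorem mixture_moments_M1_M2
    {Ω : Type} [MeasurableSpace Ω] (P : Measure Ω) [IsProbabilityMeasure P]
    (d k : ℕ) (w : Fin k → ℝ) (μ : Fin k → Fin d → ℝ) (σ2 : Fin k → ℝ≥0)
    (h : Ω → Fin k) (x : Ω → Fin d → ℝ)
    (hmeas_h : Measurable h) (hmeas_x : Measurable x)
    (hw_pos : ∀ i, 0 < w i) (hw_sum : ∑ i, w i = 1)
    (hprob : ∀ i, P (h ⁻¹' {i}) = ENNReal.ofReal (w i))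
    (hcond : ∀ i, (ProbabilityTheory.cond P (h ⁻¹' {i})).map x
        = Measure.pi fun j => ProbabilityTheory.gaussianReal (μ i j) (σ2 i))
    (hrank : (Matrix.of fun (r : Fin d) (c : Fin k) => μ c r).rank = k)
    (μbar : Fin d → ℝ) (hμbar : ∀ i, μbar i = ∫ ω, x ω i ∂P)
    (σbar2 : ℝ) (hσbar2 : σbar2 = ∑ i, w i * (σ2 i : ℝ))
    (Cov : Matrix (Fin d) (Fin d) ℝ)
    (hCov : Cov = Matrix.of fun i j => ∫ ω, (x ω i - μbar i) * (x ω j - μbar j) ∂P)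
    -- `v` is a unit-norm eigenvector of the covariance matrix with eigenvalue `σ̄²`
    (v : Fin d → ℝ) (hv_unit : v ⬝ᵥ v = 1) (hv_eig : Cov *ᵥ v = σbar2 • v)
    (M1 : Fin d → ℝ)
    (hM1 : ∀ i, M1 i = ∫ ω, x ω i * (v ⬝ᵥ (fun r => x ω r - μbar r)) ^ 2 ∂P)
    (M2 : Matrix (Fin d) (Fin d) ℝ)
    (hM2 : M2 = (Matrix.of fun i j => ∫ ω, x ω i * x ω j ∂P)
        - σbar2 • (1 : Matrix (Fin d) (Fin d) ℝ)) :
    M1 = ∑ i, (w i * (σ2 i : ℝ)) • μ i ∧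
    M2 = ∑ i, w i • Matrix.vecMulVec (μ i) (μ i) := by
  have key := mix_integral P d k w μ σ2 h x hmeas_h hmeas_x hw_pos hprob hcond
  have second : ∀ (a b : Fin d) (α β : ℝ), ∫ ω, (x ω a - α) * (x ω b - β) ∂P
      = ∑ i, w i * ((if a = b then (σ2 i : ℝ) else 0) + (μ i a - α) * (μ i b - β)) := by
    intro a b α β
    rw [key (fun y => (y a - α) * (y b - β)) (by fun_prop)]
    · refine Finset.sum_congr rfl fun i _ => ?_
      simp only [add_sub_assoc]
      rw [gz_second]
    · intro i
      simp only [add_sub_assoc]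
      exact (((allLp_coord _ _ a).add (AllLp.const _)).mul
        ((allLp_coord _ _ b).add (AllLp.const _))).integrable
  have hperp : ∀ i, v ⬝ᵥ (fun r => μ i r - μbar r) = 0 := by
    have h1 : v ⬝ᵥ (Cov *ᵥ v) = σbar2 := by rw [hv_eig, dotProduct_smul, hv_unit]; simp
    have h2 : v ⬝ᵥ (Cov *ᵥ v) = ∑ i, w i * ((σ2 i : ℝ) * (v ⬝ᵥ v)
        + (v ⬝ᵥ (fun r => μ i r - μbar r)) ^ 2) := by
      have e : ∀ i, (σ2 i : ℝ) * (v ⬝ᵥ v) + (v ⬝ᵥ (fun r => μ i r - μbar r)) ^ 2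
          = ∑ a, ∑ b, v a * v b * ((if a = b then (σ2 i : ℝ) else 0)
              + (μ i a - μbar a) * (μ i b - μbar b)) := by
        intro i
        simp only [mul_add, Finset.sum_add_distrib, sq, dotProduct, Finset.sum_mul,
          Finset.mul_sum]
        congr 1
        · simp [mul_comm]
        · rw [Finset.sum_comm]
          refine Finset.sum_congr rfl fun a _ => Finset.sum_congr rfl fun b _ => by ring
      simp only [e, Finset.mul_sum]
      rw [Finset.sum_comm]
      simp only [dotProduct, mulVec, hCov, Matrix.of_apply, second, Finset.mul_sum, Finset.sum_mul]
      refine Finset.sum_congr rfl fun a _ => ?_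
      rw [Finset.sum_comm]
      refine Finset.sum_congr rfl fun i _ => Finset.sum_congr rfl fun b _ => by ring
    have h3 : ∑ i, w i * (v ⬝ᵥ (fun r => μ i r - μbar r)) ^ 2 = 0 := by
      rw [h1, hσbar2, hv_unit] at h2
      simp only [mul_add, Finset.sum_add_distrib, mul_one] at h2
      linarith
    intro i
    have h4 := (Finset.sum_eq_zero_iff_of_nonneg
      (fun i _ => mul_nonneg (hw_pos i).le (sq_nonneg _))).1 h3 i (Finset.mem_univ i)
    have := (mul_eq_zero.1 h4).resolve_left (hw_pos i).ne'
    exact pow_eq_zero_iff (two_ne_zero) |>.1 this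
  constructor
  · funext a
    have e : ∀ i (z : Fin d → ℝ), v ⬝ᵥ (fun r => z r + μ i r - μbar r) = v ⬝ᵥ z := by
      intro i z
      have : (fun r => z r + μ i r - μbar r) = z + fun r => μ i r - μbar r := by
        funext r; simp [add_sub_assoc]
      rw [this, dotProduct_add, hperp, add_zero]
    rw [hM1, key (fun y => y a * (v ⬝ᵥ (fun r => y r - μbar r)) ^ 2)
      (by unfold dotProduct; fun_prop)]
    · simp only [e, sq, gz_third, hv_unit, Finset.sum_apply, Pi.smul_apply, smul_eq_mul]
      refine Finset.sum_congr rfl fun i _ => by ring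
    · intro i
      simp only [e, sq]
      exact (((allLp_coord _ _ a).add (AllLp.const _)).mul
        ((allLp_dot _ _ v).mul (allLp_dot _ _ v))).integrable
  · ext a b
    have h5 := second a b 0 0
    simp only [sub_zero] at h5
    simp only [hM2, Matrix.sub_apply, Matrix.of_apply, h5, Matrix.smul_apply, Matrix.one_apply,
      Matrix.sum_apply, vecMulVec_apply, smul_eq_mul, mul_add, Finset.sum_add_distrib, hσbar2]
    split_ifs <;> simp
end

section
/- Let A ∈ ℝ^{d×k} have rank k, let w be a positive probability vector, and let W ∈ ℝ^{d×k} be such that Wᵀ A diag(w)^{1/2} is orthogonal. Let Q := { e_i − e_j : 1 ≤ i < j ≤ k } ∪ { e_i : i ∈ [k] } ⊆ ℝ^k, and define γ := 1/(2·√(w_max)·√(ek)·C(k+1,2)), where w_max := max_i w_i and C(k+1,2) = (k+1)k/2. If θ ∈ ℝ^k is a random vector distributed uniformly on the unit sphere of ℝ^k, then Pr[ min_{q ∈ Q} |θᵀ Wᵀ A q| > γ ] ≥ 1/2. -/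
open MeasureTheory ProbabilityTheory Matrix
open scoped BigOperators

/-- Euclidean (ℓ²) norm of a vector in `Fin m → ℝ`. -/
noncomputable def l2norm {m : ℕ} (v : Fin m → ℝ) : ℝ :=
  Real.sqrt (∑ i, v i ^ 2)

lemma aux_gint (c : ℝ) (hc : 0 < 1 + 2 * c) :
    Integrable (fun x : ℝ => Real.exp (-c * x ^ 2)) (gaussianReal 0 1) ∧
    ∫ x, Real.exp (-c * x ^ 2) ∂(gaussianReal 0 1) = (Real.sqrt (1 + 2 * c))⁻¹ := by
  have key : ∀ x : ℝ, gaussianPDFReal 0 1 x * Real.exp (-c * x ^ 2)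
      = (Real.sqrt (2 * Real.pi))⁻¹ * Real.exp (-(1 / 2 + c) * x ^ 2) := by
    intro x
    rw [gaussianPDFReal_def]
    simp only [NNReal.coe_one, mul_one, sub_zero]
    rw [mul_assoc, ← Real.exp_add]
    congr 2
    ring
  have hb : 0 < 1 / 2 + c := by linarith
  constructor
  · rw [gaussianReal_of_var_ne_zero 0 one_ne_zero,
      integrable_withDensity_iff_integrable_smul' (measurable_gaussianPDF 0 1)
        (Filter.Eventually.of_forall fun x => gaussianPDF_lt_top)]
    simp only [toReal_gaussianPDF, smul_eq_mul, key]
    exact (integrable_exp_neg_mul_sq hb).const_mul _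
  · rw [integral_gaussianReal_eq_integral_smul one_ne_zero]
    simp only [smul_eq_mul, key]
    rw [integral_const_mul, integral_gaussian, ← Real.sqrt_inv, ← Real.sqrt_inv, ← Real.sqrt_mul (by positivity)]
    congr 1
    have := Real.pi_pos
    field_simp

lemma aux_num (k : ℕ) (hk : 0 < k) (β : ℝ) (h0 : 0 < β) (h1 : β < 1) :
    (Real.sqrt (1 / β))⁻¹ * ((Real.sqrt (((k : ℝ) - 1) / (k - β)))⁻¹) ^ (k - 1)
      ≤ Real.sqrt (β * Real.exp 1) := by
  have h2 : (Real.sqrt (1 / β))⁻¹ = Real.sqrt β := by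
    rw [← Real.sqrt_inv]; simp
  rw [h2, Real.sqrt_mul h0.le]
  apply mul_le_mul_of_nonneg_left _ (Real.sqrt_nonneg _)
  obtain ⟨n, rfl⟩ : ∃ n, k = n + 1 := ⟨k - 1, by omega⟩
  simp only [Nat.add_sub_cancel]
  push_cast
  rcases Nat.eq_zero_or_pos n with rfl | hn
  · simp
  have hn' : (0 : ℝ) < n := by exact_mod_cast hn
  apply Real.le_sqrt_of_sq_le
  rw [← pow_mul, mul_comm n 2, pow_mul, inv_pow, Real.sq_sqrt (by
    apply div_nonneg <;> linarith)]
  have h3 : (((n : ℝ) + 1 - 1) / (n + 1 - β))⁻¹ ≤ Real.exp (1 / n) := by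
    rw [inv_div, add_sub_cancel_right]
    have := Real.add_one_le_exp (1 / (n : ℝ))
    refine le_trans ?_ this
    rw [div_le_iff₀ hn', add_mul, one_div, inv_mul_cancel₀ hn'.ne']
    linarith
  have h4 : 0 ≤ (((n : ℝ) + 1 - 1) / (n + 1 - β))⁻¹ := by
    apply inv_nonneg.2
    apply div_nonneg <;> linarith
  calc _ ≤ (Real.exp (1 / n)) ^ n := pow_le_pow_left₀ h4 h3 n
    _ = Real.exp 1 := by
      rw [← Real.exp_nat_mul]; congr 1; field_simp

lemma aux_coord (k : ℕ) (i0 : Fin k) (β : ℝ) (h0 : 0 < β) (h1 : β < 1) :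
    (Measure.pi fun _ : Fin k => gaussianReal 0 1).real
      {x | k * (x i0) ^ 2 ≤ β * ∑ i, x i ^ 2} ≤ Real.sqrt (β * Real.exp 1) := by
  have hk : 0 < k := i0.pos
  have hk1 : (1 : ℝ) ≤ k := by exact_mod_cast hk
  have hkb : 0 < (k : ℝ) - β := by linarith
  set t : ℝ := (1 - β) / (2 * β * (k - β)) with ht
  have htpos : 0 < t := by
    apply div_pos (by linarith); positivity
  set c : Fin k → ℝ := fun i => if i = i0 then t * (k - β) else - (t * β) with hc
  have hc0 : 1 + 2 * c i0 = 1 / β := by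
    simp only [hc, if_true, ht]
    field_simp
    ring
  have hc1 : ∀ i, i ≠ i0 → 1 + 2 * c i = ((k : ℝ) - 1) / (k - β) := by
    intro i hi
    simp only [hc, if_neg hi, ht]
    field_simp
    ring
  have hcpos : ∀ i, 0 < 1 + 2 * c i := by
    intro i
    by_cases hi : i = i0
    · rw [hi, hc0]; positivity
    · rw [hc1 i hi]
      have : 1 < k := by
        by_contra hcon
        have : k = 1 := by omega
        subst this
        exact hi (Subsingleton.elim _ _)
      have : (1 : ℝ) < k := by exact_mod_cast this
      exact div_pos (by linarith) hkb
  set F : (Fin k → ℝ) → ℝ := fun x => ∏ i, Real.exp (- c i * x i ^ 2) with hF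
  have hFint : Integrable F (Measure.pi fun _ : Fin k => gaussianReal 0 1) :=
    Integrable.fintype_prod (f := fun i (y : ℝ) => Real.exp (- c i * y ^ 2))
      (fun i => (aux_gint (c i) (hcpos i)).1)
  have hFval : ∫ x, F x ∂(Measure.pi fun _ : Fin k => gaussianReal 0 1)
      = (Real.sqrt (1 / β))⁻¹ * ((Real.sqrt (((k : ℝ) - 1) / (k - β)))⁻¹) ^ (k - 1) := by
    rw [hF, integral_fintype_prod_eq_prod (f := fun i (y : ℝ) => Real.exp (- c i * y ^ 2))]
    rw [← Finset.mul_prod_erase Finset.univ _ (Finset.mem_univ i0),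
      (aux_gint (c i0) (hcpos i0)).2, hc0]
    congr 1
    rw [Finset.prod_congr rfl (g := fun _ => (Real.sqrt (((k : ℝ) - 1) / (k - β)))⁻¹)]
    · simp
    · intro i hi
      rw [(aux_gint (c i) (hcpos i)).2, hc1 i (Finset.ne_of_mem_erase hi)]
  have hFx : ∀ x, F x = Real.exp (t * (β * ∑ i, x i ^ 2 - k * (x i0) ^ 2)) := by
    intro x
    rw [hF]
    simp only
    rw [← Real.exp_sum]
    congr 1
    have : ∀ i, - c i * x i ^ 2 = t * β * x i ^ 2 - if i = i0 then t * k * x i0 ^ 2 else 0 := by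
      intro i
      by_cases hi : i = i0
      · subst hi; simp [hc]; ring
      · simp [hc, hi]
    simp only [this, Finset.sum_sub_distrib, ← Finset.mul_sum, Finset.sum_ite_eq', Finset.mem_univ, if_true]
    ring
  have hM := mul_meas_ge_le_integral_of_nonneg (μ := Measure.pi fun _ : Fin k => gaussianReal 0 1)
    (f := F) (Filter.Eventually.of_forall fun x => by
      simp only [hFx, Pi.zero_apply]; positivity) hFint 1
  rw [one_mul, hFval] at hM
  refine le_trans ?_ (hM.trans (aux_num k hk β h0 h1))
  refine measureReal_mono ?_
  intro x hx
  simp only [Set.mem_ofPred_eq] at hx ⊢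
  rw [hFx]
  apply Real.one_le_exp
  apply mul_nonneg htpos.le
  linarith

lemma aux_dir (k : ℕ) (hk : 0 < k) (u : Fin k → ℝ) (hu : ∑ i, u i ^ 2 = 1)
    (β : ℝ) (h0 : 0 < β) (h1 : β < 1) :
    (Measure.pi fun _ : Fin k => gaussianReal 0 1).real
      {x | k * (x ⬝ᵥ u) ^ 2 ≤ β * ∑ i, x i ^ 2} ≤ Real.sqrt (β * Real.exp 1) := by
  set i0 : Fin k := ⟨0, hk⟩
  set U : EuclideanSpace ℝ (Fin k) := WithLp.toLp 2 u with hU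
  have hUn : ‖U‖ = 1 := by
    rw [EuclideanSpace.norm_eq]
    simp [hU, hu]
  have hon : Orthonormal ℝ (({i0} : Set (Fin k)).domRestrict (fun _ => U)) := by
    constructor
    · intro i; exact hUn
    · intro i j hij; exact absurd (Subsingleton.elim i j) hij
  obtain ⟨b, hb⟩ := hon.exists_orthonormalBasis_extension_of_card_eq (by simp)
  have hb0 : b i0 = U := hb i0 (by simp)
  have h := (map_pi_eq_stdGaussian (ι := Fin k)).trans (stdGaussian_eq_map_pi_orthonormalBasis b)
  set S : Set (EuclideanSpace ℝ (Fin k)) := {y | k * (inner ℝ U y) ^ 2 ≤ β * ‖y‖ ^ 2} with hS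
  have hSm : MeasurableSet S := by
    apply IsClosed.measurableSet
    apply isClosed_le <;> fun_prop
  have h2 := congrArg (fun m => m S) h
  simp only at h2
  rw [Measure.map_apply (by fun_prop) hSm, Measure.map_apply (by fun_prop) hSm] at h2
  have e1 : (WithLp.toLp 2) ⁻¹' S = {x : Fin k → ℝ | k * (x ⬝ᵥ u) ^ 2 ≤ β * ∑ i, x i ^ 2} := by
    ext x
    simp [hS, hU, EuclideanSpace.norm_sq_eq, PiLp.inner_apply, dotProduct]
  have e2 : (fun x : Fin k → ℝ => ∑ i, x i • b i) ⁻¹' S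
      = {x : Fin k → ℝ | k * (x i0) ^ 2 ≤ β * ∑ i, x i ^ 2} := by
    ext x
    have i1 : inner ℝ U (∑ i, x i • b i) = x i0 := by
      rw [← hb0]; exact b.orthonormal.inner_right_fintype x i0
    have i2 : ‖∑ i, x i • b i‖ ^ 2 = ∑ i, x i ^ 2 := by
      rw [← real_inner_self_eq_norm_sq, b.orthonormal.inner_sum]
      simp [sq]
    simp only [hS, Set.mem_preimage, Set.mem_ofPred_eq, i1, i2]
  rw [e1, e2] at h2
  have h3 := aux_coord k i0 β h0 h1
  rw [measureReal_def] at h3 ⊢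
  rwa [h2]

lemma aux_dir' (k : ℕ) (hk : 0 < k) (v : Fin k → ℝ) (m γ : ℝ) (hm : 0 < m) (hγ : 0 < γ)
    (hv : 1 / m ≤ ∑ i, v i ^ 2) (h1 : k * m * γ ^ 2 < 1) :
    (Measure.pi fun _ : Fin k => gaussianReal 0 1).real
      {x | (x ⬝ᵥ v) ^ 2 ≤ γ ^ 2 * ∑ i, x i ^ 2} ≤ Real.sqrt (k * m * γ ^ 2 * Real.exp 1) := by
  have hk' : (0 : ℝ) < k := by exact_mod_cast hk
  set N := ∑ i, v i ^ 2 with hN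
  have hNpos : 0 < N := lt_of_lt_of_le (by positivity) hv
  have hs := Real.sq_sqrt hNpos.le
  have hsp := Real.sqrt_pos.2 hNpos
  have := aux_dir k hk ((Real.sqrt N)⁻¹ • v) (by
    simp only [Pi.smul_apply, smul_eq_mul, mul_pow, ← Finset.mul_sum, ← hN, inv_pow, hs]
    field_simp) (k * m * γ ^ 2) (by positivity) h1
  refine le_trans (measureReal_mono ?_) this
  intro x hx
  simp only [Set.mem_ofPred_eq, dotProduct_smul, smul_eq_mul, mul_pow, inv_pow, hs] at hx ⊢
  have hiN : N⁻¹ ≤ m := by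
    rw [inv_le_comm₀ hNpos hm]; simpa using hv
  calc k * (N⁻¹ * (x ⬝ᵥ v) ^ 2) ≤ k * (m * (γ ^ 2 * ∑ i, x i ^ 2)) := by gcongr
    _ = _ := by ring

lemma aux_norm (k : ℕ) (B : Matrix (Fin k) (Fin k) ℝ) (w : Fin k → ℝ) (hw : ∀ i, 0 < w i)
    (hB : (B * Matrix.diagonal fun i => Real.sqrt (w i))ᵀ *
        (B * Matrix.diagonal fun i => Real.sqrt (w i)) = 1) (q : Fin k → ℝ) :
    ∑ i, (B *ᵥ q) i ^ 2 = ∑ i, q i ^ 2 / w i := by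
  have hq : B *ᵥ q = (B * Matrix.diagonal fun i => Real.sqrt (w i)) *ᵥ
      (fun i => q i / Real.sqrt (w i)) := by
    rw [← Matrix.mulVec_mulVec]
    congr 1
    ext i
    rw [Matrix.mulVec_diagonal]
    have := Real.sqrt_pos.2 (hw i)
    field_simp
  have : ∑ i, (B *ᵥ q) i ^ 2 = (B *ᵥ q) ⬝ᵥ (B *ᵥ q) := by
    simp [dotProduct, sq]
  rw [this, hq, Matrix.dotProduct_mulVec, ← Matrix.mulVec_transpose, Matrix.mulVec_mulVec, hB,
    Matrix.one_mulVec]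
  simp only [dotProduct]
  refine Finset.sum_congr rfl fun i _ => ?_
  rw [div_mul_div_comm, Real.mul_self_sqrt (hw i).le, sq]

/-- **Random separation.**
Let `A ∈ ℝ^{d×k}` have rank `k`, `w` a positive probability vector, and `W` such that
`Wᵀ A diag(w)^{1/2}` is orthogonal. Let
`Q = {e_i − e_j : i < j} ∪ {e_i : i ∈ [k]}` and
`γ = 1/(2 √w_max √(e k) C(k+1,2))`. If `θ` is a uniformly random unit vector in ℝ^k
(realized by normalizing a standard Gaussian vector `g`), then with probability at
least `1/2`, `|θᵀ Wᵀ A q| > γ` for all `q ∈ Q`. -/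
theorem random_separation
    {Ω : Type} [MeasurableSpace Ω] (P : Measure Ω) [IsProbabilityMeasure P]
    (d k : ℕ) (hk : 0 < k)
    (A : Matrix (Fin d) (Fin k) ℝ) (hrank : A.rank = k)
    (w : Fin k → ℝ) (hw_pos : ∀ i, 0 < w i) (hw_sum : ∑ i, w i = 1)
    (W : Matrix (Fin d) (Fin k) ℝ)
    (hWorth : (Wᵀ * A * Matrix.diagonal fun i => Real.sqrt (w i))ᵀ *
        (Wᵀ * A * Matrix.diagonal fun i => Real.sqrt (w i)) = 1 ∧
      (Wᵀ * A * Matrix.diagonal fun i => Real.sqrt (w i)) *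
        (Wᵀ * A * Matrix.diagonal fun i => Real.sqrt (w i))ᵀ = 1)
    -- the finite set of test vectors
    (Q : Set (Fin k → ℝ))
    (hQ : Q = {q | ∃ i j : Fin k, i ≠ j ∧ q = Pi.single i (1 : ℝ) - Pi.single j 1} ∪
      {q | ∃ i : Fin k, q = Pi.single i (1 : ℝ)})
    (wmax : ℝ) (hwmax : wmax = Finset.univ.sup' ⟨⟨0, hk⟩, Finset.mem_univ _⟩ w)
    (γ : ℝ)
    (hγ : γ = 1 / (2 * Real.sqrt wmax * Real.sqrt (Real.exp 1 * k) *
      (Nat.choose (k + 1) 2 : ℝ)))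
    -- `θ` is uniformly distributed on the unit sphere of ℝ^k: it is a normalized
    -- standard Gaussian vector
    (g : Ω → Fin k → ℝ) (hg_meas : Measurable g)
    (hg_law : P.map g = Measure.pi fun _ => ProbabilityTheory.gaussianReal 0 1)
    (θ : Ω → Fin k → ℝ) (hθ : ∀ ω, θ ω = (l2norm (g ω))⁻¹ • g ω) :
    (1 : ENNReal) / 2 ≤ P {ω | ∀ q ∈ Q, γ < |θ ω ⬝ᵥ ((Wᵀ * A) *ᵥ q)|} := by
  have hk' : (0 : ℝ) < k := by exact_mod_cast hk
  have hwle : ∀ i, w i ≤ wmax := fun i => by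
    rw [hwmax]; exact Finset.le_sup' w (Finset.mem_univ i)
  have hm : 0 < wmax := lt_of_lt_of_le (hw_pos ⟨0, hk⟩) (hwle _)
  set C : ℝ := (Nat.choose (k + 1) 2 : ℝ) with hC
  have hC1 : 1 ≤ C := by
    rw [hC]; exact_mod_cast Nat.choose_pos (by omega)
  have hγpos : 0 < γ := by rw [hγ]; positivity
  have hβ : k * wmax * γ ^ 2 = 1 / (4 * Real.exp 1 * C ^ 2) := by
    rw [hγ, div_pow, mul_pow, mul_pow, mul_pow, Real.sq_sqrt hm.le, Real.sq_sqrt (by positivity)]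
    field_simp
    norm_num
  have he : 1 < Real.exp 1 := by simp
  have hβ1 : k * wmax * γ ^ 2 < 1 := by
    rw [hβ, div_lt_one (by positivity)]
    have : 1 ≤ C ^ 2 := one_le_pow₀ hC1
    nlinarith
  have hβ2 : Real.sqrt (k * wmax * γ ^ 2 * Real.exp 1) = 1 / (2 * C) := by
    rw [hβ, show 1 / (4 * Real.exp 1 * C ^ 2) * Real.exp 1 = (1 / (2 * C)) ^ 2 by
      field_simp; norm_num]
    exact Real.sqrt_sq (by positivity)
  -- bound for one test vector
  have hone : ∀ q ∈ Q, (P.map g).real {x | (x ⬝ᵥ ((Wᵀ * A) *ᵥ q)) ^ 2 ≤ γ ^ 2 * ∑ i, x i ^ 2}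
      ≤ 1 / (2 * C) := by
    intro q hq
    rw [hg_law, ← hβ2]
    apply aux_dir' k hk _ wmax γ hm hγpos _ hβ1
    rw [aux_norm k (Wᵀ * A) w hw_pos hWorth.1 q]
    obtain ⟨i, hi⟩ : ∃ i, q i ^ 2 = 1 := by
      rw [hQ] at hq
      rcases hq with ⟨i, j, hij, rfl⟩ | ⟨i, rfl⟩
      · exact ⟨i, by simp [hij]⟩
      · exact ⟨i, by simp⟩
    calc 1 / wmax ≤ q i ^ 2 / w i := by
          rw [hi]; exact one_div_le_one_div_of_le (hw_pos i) (hwle i)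
      _ ≤ _ := Finset.single_le_sum (f := fun i => q i ^ 2 / w i)
          (fun j _ => div_nonneg (sq_nonneg _) (hw_pos j).le) (Finset.mem_univ i)
  let T : Sym2 (Fin k) → (Fin k → ℝ) := fun s =>
    if (Quot.out s).1 = (Quot.out s).2 then Pi.single (Quot.out s).1 1
    else Pi.single (Quot.out s).1 1 - Pi.single (Quot.out s).2 1
  have hTQ : ∀ s, T s ∈ Q := by
    intro s
    rw [hQ]
    by_cases h : (Quot.out s).1 = (Quot.out s).2
    · right; exact ⟨(Quot.out s).1, by simp only [T, if_pos h]⟩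
    · left; exact ⟨(Quot.out s).1, (Quot.out s).2, h, by simp only [T, if_neg h]⟩
  have hT : ∀ q ∈ Q, ∃ s, q = T s ∨ q = - T s := by
    have hout : ∀ i j : Fin k, (Quot.out s(i, j) = (i, j)) ∨ (Quot.out s(i, j) = (j, i)) := by
      intro i j
      have h : Sym2.mk (Quot.out s(i, j)).1 (Quot.out s(i, j)).2 = s(i, j) := Quot.out_eq _
      rw [Sym2.eq_iff] at h
      rcases h with ⟨h1, h2⟩ | ⟨h1, h2⟩
      · left; exact Prod.ext h1 h2
      · right; exact Prod.ext h1 h2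
    intro q hq
    rw [hQ] at hq
    rcases hq with ⟨i, j, hij, rfl⟩ | ⟨i, rfl⟩
    · refine ⟨s(i, j), ?_⟩
      rcases hout i j with h | h
      · left; simp [T, h, hij]
      · right; simp [T, h, hij.symm]
    · refine ⟨s(i, i), ?_⟩
      have h : Quot.out s(i, i) = (i, i) := by simpa using hout i i
      left; simp [T, h]
  let S : Sym2 (Fin k) → Set (Fin k → ℝ) := fun s =>
    {x | (x ⬝ᵥ ((Wᵀ * A) *ᵥ T s)) ^ 2 ≤ γ ^ 2 * ∑ i, x i ^ 2}
  have hSm : ∀ s, MeasurableSet (S s) := by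
    intro s
    apply measurableSet_le
    · simp only [dotProduct]; fun_prop
    · fun_prop
  have hU : P.real (g ⁻¹' (⋃ s, S s)) ≤ 1 / 2 := by
    rw [← map_measureReal_apply hg_meas (MeasurableSet.iUnion hSm)]
    calc (P.map g).real (⋃ s, S s) ≤ ∑ s, (P.map g).real (S s) := measureReal_iUnion_fintype_le _
      _ ≤ ∑ s : Sym2 (Fin k), 1 / (2 * C) := Finset.sum_le_sum fun s _ => hone _ (hTQ s)
      _ = 1 / 2 := by
        rw [Finset.sum_const, Finset.card_univ, Sym2.card, Fintype.card_fin, nsmul_eq_mul, ← hC]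
        field_simp
  have hsub : (g ⁻¹' (⋃ s, S s))ᶜ ⊆ {ω | ∀ q ∈ Q, γ < |θ ω ⬝ᵥ ((Wᵀ * A) *ᵥ q)|} := by
    intro ω hω q hq
    obtain ⟨s, hs⟩ := hT q hq
    have hns : ¬ ((g ω ⬝ᵥ ((Wᵀ * A) *ᵥ T s)) ^ 2 ≤ γ ^ 2 * ∑ i, g ω i ^ 2) := by
      intro hcon
      exact hω (Set.mem_iUnion.2 ⟨s, hcon⟩)
    have habs : |θ ω ⬝ᵥ ((Wᵀ * A) *ᵥ q)| = |θ ω ⬝ᵥ ((Wᵀ * A) *ᵥ T s)| := by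
      rcases hs with rfl | rfl
      · rfl
      · rw [Matrix.mulVec_neg, dotProduct_neg, abs_neg]
    rw [habs, hθ, smul_dotProduct, smul_eq_mul]
    by_contra hcon
    apply hns
    push Not at hcon
    have hnn : 0 ≤ ∑ i, g ω i ^ 2 := Finset.sum_nonneg fun i _ => sq_nonneg _
    rcases hnn.eq_or_lt with h | h
    · have hz : g ω = 0 := by
        ext i
        have := (Finset.sum_eq_zero_iff_of_nonneg (fun i _ => sq_nonneg (g ω i))).1 h.symm i
          (Finset.mem_univ i)
        simpa using this
      simp [hz]
    · have hl : 0 < l2norm (g ω) := Real.sqrt_pos.2 h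
      have hl2 : l2norm (g ω) ^ 2 = ∑ i, g ω i ^ 2 := Real.sq_sqrt hnn
      rw [abs_mul, abs_of_pos (inv_pos.2 hl), inv_mul_le_iff₀ hl] at hcon
      rw [← hl2, ← mul_pow, ← sq_abs]
      apply pow_le_pow_left₀ (abs_nonneg _)
      linarith
  refine le_trans ?_ (measure_mono hsub)
  have hmU : MeasurableSet (g ⁻¹' (⋃ s, S s)) := hg_meas (MeasurableSet.iUnion hSm)
  have hcompl := probReal_compl_eq_one_sub (μ := P) hmU
  rw [← ofReal_measureReal, hcompl]
  have : (1 : ENNReal) / 2 = ENNReal.ofReal (1 / 2) := by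
    rw [ENNReal.ofReal_div_of_pos (by norm_num)]; simp
  rw [this]
  apply ENNReal.ofReal_le_ofReal
  linarith
end
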